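/- Let L ≥ 2, J ∈ ℝ, η ∈ ℂ with sinh η ≠ 0, and λ ∈ ℂ with sinh(λ+η) ≠ 0; set Δ = cosh η. Then the transfer matrix commutes with the XXZ Hamiltonian: T(λ) H₀ = H₀ T(λ) as operators on (ℂ²)^{⊗L}. -/

import Mathlib

open Complex Matrix

/-- The six-vertex R-matrix on ℂ² ⊗ ℂ², in the basis `e₁⊗e₁, e₁⊗e₂, e₂⊗e₁, e₂⊗e₂`
(encoded as pairs `(0,0), (0,1), (1,0), (1,1)` in `Fin 2 × Fin 2`). -/
noncomputable def Rmat (η lam : ℂ) : Matrix (Fin 2 × Fin 2) (Fin 2 × Fin 2) ℂ :=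
  Matrix.of fun p q =>
    if p = q then (if p.1 = p.2 then 1 else Complex.sinh lam / Complex.sinh (lam + η))
    else if p.1 = q.2 ∧ p.2 = q.1 ∧ p.1 ≠ p.2 then Complex.sinh η / Complex.sinh (lam + η)
    else 0

/-- Basis states of the chain `(ℂ²)^{⊗L}`. -/
abbrev Chain (L : ℕ) := Fin L → Fin 2

/-- `R_{aj}(λ)`: the R-matrix acting on the auxiliary factor and the `j`-th site of the
chain, and as the identity on all other sites. -/
noncomputable def Raux (L : ℕ) (η lam : ℂ) (j : Fin L) :
    Matrix (Fin 2 × Chain L) (Fin 2 × Chain L) ℂ :=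
  Matrix.of fun p q =>
    Rmat η lam (p.1, p.2 j) (q.1, q.2 j) * (if ∀ k, k ≠ j → p.2 k = q.2 k then 1 else 0)

/-- The monodromy matrix `𝒯_a(λ) = R_{aL}(λ) ⋯ R_{a2}(λ) R_{a1}(λ)` on `ℂ²_a ⊗ (ℂ²)^{⊗L}`. -/
noncomputable def monodromy (L : ℕ) (η lam : ℂ) :
    Matrix (Fin 2 × Chain L) (Fin 2 × Chain L) ℂ :=
  ((List.ofFn fun j : Fin L => Raux L η lam j).reverse).prod

/-- `A(λ)`, the upper-left block of the monodromy matrix w.r.t. the auxiliary space. -/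
noncomputable def Aop (L : ℕ) (η lam : ℂ) : Matrix (Chain L) (Chain L) ℂ :=
  Matrix.of fun v w => monodromy L η lam (0, v) (0, w)

/-- `B(λ)`, the upper-right block of the monodromy matrix w.r.t. the auxiliary space. -/
noncomputable def Bop (L : ℕ) (η lam : ℂ) : Matrix (Chain L) (Chain L) ℂ :=
  Matrix.of fun v w => monodromy L η lam (0, v) (1, w)

/-- `C(λ)`, the lower-left block of the monodromy matrix w.r.t. the auxiliary space. -/
noncomputable def Cop (L : ℕ) (η lam : ℂ) : Matrix (Chain L) (Chain L) ℂ :=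
  Matrix.of fun v w => monodromy L η lam (1, v) (0, w)

/-- `D(λ)`, the lower-right block of the monodromy matrix w.r.t. the auxiliary space. -/
noncomputable def Dop (L : ℕ) (η lam : ℂ) : Matrix (Chain L) (Chain L) ℂ :=
  Matrix.of fun v w => monodromy L η lam (1, v) (1, w)

/-- The transfer matrix `T(λ) = Tr_a 𝒯_a(λ) = A(λ) + D(λ)` on `(ℂ²)^{⊗L}`. -/
noncomputable def transfer (L : ℕ) (η lam : ℂ) : Matrix (Chain L) (Chain L) ℂ :=
  Matrix.of fun v w => ∑ a : Fin 2, monodromy L η lam (a, v) (a, w)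

/-- The Pauli matrices `σ^x, σ^y, σ^z` (indexed by `0, 1, 2` ↔ `x, y, z`). -/
noncomputable def pauli : Fin 3 → Matrix (Fin 2) (Fin 2) ℂ :=
  ![!![0, 1; 1, 0], !![0, -Complex.I; Complex.I, 0], !![1, 0; 0, -1]]

/-- `σ_j`: the one-site operator `m` acting on the `j`-th tensor factor of `(ℂ²)^{⊗L}`
and as the identity on all other factors. -/
noncomputable def siteOp (L : ℕ) (m : Matrix (Fin 2) (Fin 2) ℂ) (j : Fin L) :
    Matrix (Chain L) (Chain L) ℂ :=
  Matrix.of fun v w => m (v j) (w j) * (if ∀ k, k ≠ j → v k = w k then 1 else 0)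

/-- The spin-1/2 XXZ Hamiltonian with periodic boundary conditions:
`H₀ = J Σ_j [σ_j^x σ_{j+1}^x + σ_j^y σ_{j+1}^y + Δ(σ_j^z σ_{j+1}^z − 1)]`,
with site indices modulo `L`. -/
noncomputable def XXZham (L : ℕ) [NeZero L] (J : ℝ) (Δ : ℂ) :
    Matrix (Chain L) (Chain L) ℂ :=
  (J : ℂ) • ∑ j : Fin L,
    (siteOp L (pauli 0) j * siteOp L (pauli 0) (j + 1) +
      siteOp L (pauli 1) j * siteOp L (pauli 1) (j + 1) +
      Δ • (siteOp L (pauli 2) j * siteOp L (pauli 2) (j + 1) - 1))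

/-- The total spin operator `S^z = (1/2) Σ_j σ_j^z`. -/
noncomputable def Sz (L : ℕ) : Matrix (Chain L) (Chain L) ℂ :=
  (2 : ℂ)⁻¹ • ∑ j : Fin L, siteOp L (pauli 2) j

open Finset in
/-- Summing over the configurations that agree with `v` off the site `j`. -/
lemma sum_mul_ite_eq_off {L : ℕ} (j : Fin L) (v : Chain L) (f : Chain L → ℂ) :
    ∑ u, f u * (if ∀ k, k ≠ j → v k = u k then 1 else 0) =
      ∑ s, f (Function.update v j s) := by
  have h : (univ.filter fun u : Chain L => ∀ k, k ≠ j → v k = u k) =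
      univ.image (Function.update v j) := by
    ext u
    simp only [mem_filter, mem_univ, true_and, mem_image]
    constructor
    · intro hu
      refine ⟨u j, funext fun k => ?_⟩
      by_cases hk : k = j
      · subst hk; simp
      · simp [hk, hu k hk]
    · rintro ⟨s, rfl⟩ k hk
      simp [hk]
  simp only [mul_ite, mul_one, mul_zero]
  rw [← sum_filter, h, sum_image fun _ _ _ _ e => Function.update_injective v j e]

lemma siteOp_mul_apply {L : ℕ} (m : Matrix (Fin 2) (Fin 2) ℂ) (j : Fin L)
    (X : Matrix (Chain L) (Chain L) ℂ) (v w : Chain L) :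
    (siteOp L m j * X) v w = ∑ s, m (v j) s * X (Function.update v j s) w := by
  have h := sum_mul_ite_eq_off j v fun u => m (v j) (u j) * X u w
  simp only [Function.update_self] at h
  rw [← h, Matrix.mul_apply]
  exact Finset.sum_congr rfl fun u _ => by simp only [siteOp, of_apply]; ring

lemma mul_siteOp_apply {L : ℕ} (m : Matrix (Fin 2) (Fin 2) ℂ) (j : Fin L)
    (X : Matrix (Chain L) (Chain L) ℂ) (v w : Chain L) :
    (X * siteOp L m j) v w = ∑ s, X v (Function.update w j s) * m s (w j) := by
  have h := sum_mul_ite_eq_off j w fun u => X v u * m (u j) (w j)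
  simp only [Function.update_self] at h
  rw [← h, Matrix.mul_apply]
  refine Finset.sum_congr rfl fun u _ => ?_
  simp only [siteOp, of_apply, eq_comm (a := w _)]
  ring

lemma Raux_mul_apply {L : ℕ} (η lam : ℂ) (j : Fin L)
    (X : Matrix (Fin 2 × Chain L) (Fin 2 × Chain L) ℂ) (a : Fin 2) (v : Chain L)
    (q : Fin 2 × Chain L) :
    (Raux L η lam j * X) (a, v) q =
      ∑ c, ∑ s, Rmat η lam (a, v j) (c, s) * X (c, Function.update v j s) q := by
  rw [Matrix.mul_apply, Fintype.sum_prod_type]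
  refine Finset.sum_congr rfl fun c _ => ?_
  have h := sum_mul_ite_eq_off j v fun u => Rmat η lam (a, v j) (c, u j) * X (c, u) q
  simp only [Function.update_self] at h
  rw [← h]
  exact Finset.sum_congr rfl fun u _ => by simp only [Raux, of_apply]; ring

/-- The matrix on the auxiliary space obtained from an operator on `ℂ²_a ⊗ ℂ²` by taking the
matrix element between the basis states `s` and `t` of the second factor. -/
def auxBlock (R : Matrix (Fin 2 × Fin 2) (Fin 2 × Fin 2) ℂ) (s t : Fin 2) :
    Matrix (Fin 2) (Fin 2) ℂ :=
  Matrix.of fun a b => R (a, s) (b, t)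

lemma prod_map_Raux_apply {L : ℕ} (η lam : ℂ) (l : List (Fin L)) (hl : l.Nodup)
    (a b : Fin 2) (v w : Chain L) :
    (l.map (Raux L η lam)).prod (a, v) (b, w) =
      (l.map fun j => auxBlock (Rmat η lam) (v j) (w j)).prod a b *
        (if ∀ k, k ∉ l → v k = w k then 1 else 0) := by
  induction l generalizing a v with
  | nil =>
    simp only [List.map_nil, List.prod_nil, Matrix.one_apply, Prod.mk.injEq, funext_iff, ite_and,
      List.not_mem_nil, not_false_eq_true, forall_const]
    split_ifs <;> simp
  | cons j l ih =>
    obtain ⟨hj, hl⟩ := List.nodup_cons.1 hl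
    have key (s : Fin 2) : (∀ k, k ∉ l → Function.update v j s k = w k) ↔
        s = w j ∧ ∀ k, k ∉ j :: l → v k = w k := by
      constructor
      · intro h
        refine ⟨by simpa using h j hj, fun k hk => ?_⟩
        rw [List.mem_cons, not_or] at hk
        simpa [hk.1] using h k hk.2
      · rintro ⟨rfl, h⟩ k hk
        by_cases hkj : k = j
        · subst hkj; simp
        · simpa [hkj] using h k (by simp [hkj, hk])
    have hmap (s : Fin 2) :
        (l.map fun i => auxBlock (Rmat η lam) (Function.update v j s i) (w i)) =
          l.map fun i => auxBlock (Rmat η lam) (v i) (w i) :=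
      List.map_congr_left fun i hi => by
        rw [Function.update_of_ne (ne_of_mem_of_not_mem hi hj)]
    rw [List.map_cons, List.map_cons, List.prod_cons, List.prod_cons, Raux_mul_apply,
      Matrix.mul_apply, Finset.sum_mul]
    simp only [ih hl, hmap, key, ite_and]
    refine Finset.sum_congr rfl fun c _ => ?_
    rw [Finset.sum_eq_single (w j)]
    · simp only [if_true, auxBlock, of_apply]; ring
    · intro s _ hs; simp [hs]
    · simp

/-- The trace of the product `f (L-1) ⋯ f 1 f 0`. -/
def orderedTrace {L : ℕ} (f : Fin L → Matrix (Fin 2) (Fin 2) ℂ) : ℂ :=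
  (List.ofFn f).reverse.prod.trace

lemma transfer_apply (L : ℕ) (η lam : ℂ) (v w : Chain L) :
    transfer L η lam v w = orderedTrace fun j => auxBlock (Rmat η lam) (v j) (w j) := by
  have h (a : Fin 2) := prod_map_Raux_apply η lam (List.finRange L).reverse
    (List.nodup_reverse.2 (List.nodup_finRange L)) a a v w
  simp only [List.mem_reverse, List.mem_finRange, not_true_eq_false, false_imp_iff, implies_true,
    if_true, mul_one, List.map_reverse, ← List.ofFn_eq_map] at h
  simp only [transfer, monodromy, orderedTrace, of_apply, h, Matrix.trace, Matrix.diag]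

lemma orderedTrace_comp_add_one {n : ℕ} (f : Fin (n + 1) → Matrix (Fin 2) (Fin 2) ℂ) :
    orderedTrace (fun k => f (k + 1)) = orderedTrace f := by
  rw [orderedTrace, orderedTrace, List.ofFn_succ', List.ofFn_succ (f := f)]
  simp [Matrix.trace_mul_comm (f 0), Fin.coeSucc_eq_succ]

lemma orderedTrace_comp_add {n : ℕ} (f : Fin (n + 1) → Matrix (Fin 2) (Fin 2) ℂ)
    (j : Fin (n + 1)) : orderedTrace (fun k => f (k + j)) = orderedTrace f := by
  induction j using Fin.induction with
  | zero => simp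
  | succ i ih =>
    rw [← ih, ← orderedTrace_comp_add_one fun k => f (k + i.castSucc)]
    simp only [← Fin.coeSucc_eq_succ, add_assoc, add_comm (1 : Fin (n + 1))]

/-- The factors at neighbouring sites `j` and `j + 1` can be isolated in an ordered trace. -/
lemma exists_orderedTrace_eq_trace_mul {n : ℕ} (f : Fin (n + 2) → Matrix (Fin 2) (Fin 2) ℂ)
    (j : Fin (n + 2)) :
    ∃ C : Matrix (Fin 2) (Fin 2) ℂ, ∀ g : Fin (n + 2) → Matrix (Fin 2) (Fin 2) ℂ,
      (∀ k, k ≠ j → k ≠ j + 1 → g k = f k) →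
        orderedTrace g = (g (j + 1) * g j * C).trace := by
  refine ⟨(List.ofFn fun k : Fin n => f (k.succ.succ + j)).reverse.prod, fun g hg => ?_⟩
  have h : (fun k : Fin n => g (k.succ.succ + j)) = fun k => f (k.succ.succ + j) := by
    funext k
    refine hg _ (fun e => ?_) (fun e => ?_)
    · exact Fin.succ_ne_zero _ (left_eq_add.1 (e.symm.trans (add_comm _ _)))
    · rw [add_comm j, add_left_inj, ← Fin.succ_zero_eq_one] at e
      exact Fin.succ_ne_zero _ (Fin.succ_injective _ e)
  rw [← orderedTrace_comp_add g j, orderedTrace, List.ofFn_succ, List.ofFn_succ, h]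
  simp only [List.reverse_cons, List.prod_append, List.prod_singleton, Fin.succ_zero_eq_one,
    zero_add, add_comm 1 j]
  rw [Matrix.trace_mul_comm (g (j + 1) * g j), mul_assoc]

/-- The six-vertex weights `a, b, c` arranged as an operator on `ℂ² ⊗ ℂ²`. -/
def sixVertex (a b c : ℂ) : Matrix (Fin 2 × Fin 2) (Fin 2 × Fin 2) ℂ :=
  Matrix.of fun p q =>
    if p = q then (if p.1 = p.2 then a else b)
    else if p.1 = q.2 ∧ p.2 = q.1 ∧ p.1 ≠ p.2 then c
    else 0

lemma auxBlock_sixVertex (a b c : ℂ) (s t : Fin 2) :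
    auxBlock (sixVertex a b c) s t =
      (!![!![a, 0; 0, b], !![0, 0; c, 0]; !![0, c; 0, 0], !![b, 0; 0, a]] :
        Matrix (Fin 2) (Fin 2) (Matrix (Fin 2) (Fin 2) ℂ)) s t := by
  ext i k
  fin_cases s <;> fin_cases t <;> fin_cases i <;> fin_cases k <;> simp [auxBlock, sixVertex]

/-- The two-site XXZ interaction is of six-vertex form. -/
lemma pauli_bond_eq_sixVertex (Δ : ℂ) (s t s' t' : Fin 2) :
    pauli 0 s s' * pauli 0 t t' + pauli 1 s s' * pauli 1 t t' +
        Δ * (pauli 2 s s' * pauli 2 t t' - if s = s' ∧ t = t' then 1 else 0) =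
      sixVertex 0 (-2 * Δ) 2 (s, t) (s', t') := by
  fin_cases s <;> fin_cases t <;> fin_cases s' <;> fin_cases t' <;>
    simp [pauli, sixVertex] <;> ring

/-- Sutherland's relation: the commutator of the two-site interaction with two neighbouring
six-vertex operators is a difference. -/
lemma sutherland (Δ b c : ℂ) (h : 1 + b ^ 2 - c ^ 2 = 2 * Δ * b) (s t s' t' : Fin 2) :
    ∑ x, ∑ y, sixVertex 0 (-2 * Δ) 2 (s, t) (x, y) •
        (auxBlock (sixVertex 1 b c) y t' * auxBlock (sixVertex 1 b c) x s') -
      ∑ x, ∑ y, sixVertex 0 (-2 * Δ) 2 (x, y) (s', t') •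
        (auxBlock (sixVertex 1 b c) t y * auxBlock (sixVertex 1 b c) s x) =
      auxBlock (sixVertex 1 b c) t t' *
          auxBlock (sixVertex 0 (2 * c ^ 2) (2 * c * (b - Δ))) s s' -
        auxBlock (sixVertex 0 (2 * c ^ 2) (2 * c * (b - Δ))) t t' *
          auxBlock (sixVertex 1 b c) s s' := by
  simp only [auxBlock_sixVertex, Fin.sum_univ_two]
  fin_cases s <;> fin_cases t <;> fin_cases s' <;> fin_cases t' <;>
    rw [← Matrix.ext_iff] <;> simp [sixVertex, Fin.forall_fin_two] <;> grind

/-- The interaction of the sites `j` and `k` in the XXZ Hamiltonian. -/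
noncomputable def bondOp (L : ℕ) (Δ : ℂ) (j k : Fin L) : Matrix (Chain L) (Chain L) ℂ :=
  siteOp L (pauli 0) j * siteOp L (pauli 0) k + siteOp L (pauli 1) j * siteOp L (pauli 1) k +
    Δ • (siteOp L (pauli 2) j * siteOp L (pauli 2) k - 1)

lemma sum_sum_ite_update {L : ℕ} {j k : Fin L} (v : Chain L) (f : Chain L → ℂ) :
    f v = ∑ s, ∑ t, (if v j = s ∧ v k = t then 1 else 0) *
      f (Function.update (Function.update v j s) k t) := by
  simp [ite_and]

lemma bondOp_mul_apply {L : ℕ} (Δ : ℂ) {j k : Fin L} (hjk : j ≠ k)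
    (X : Matrix (Chain L) (Chain L) ℂ) (v w : Chain L) :
    (bondOp L Δ j k * X) v w = ∑ s, ∑ t, sixVertex 0 (-2 * Δ) 2 (v j, v k) (s, t) *
      X (Function.update (Function.update v j s) k t) w := by
  simp only [bondOp, add_mul, sub_mul, one_mul, smul_mul_assoc, mul_assoc, Matrix.add_apply,
    Matrix.sub_apply, Matrix.smul_apply, siteOp_mul_apply, smul_eq_mul,
    Function.update_of_ne hjk.symm]
  rw [sum_sum_ite_update (j := j) (k := k) v fun u => X u w]
  simp only [Finset.mul_sum, ← Finset.sum_add_distrib, ← Finset.sum_sub_distrib,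
    ← pauli_bond_eq_sixVertex]
  refine Finset.sum_congr rfl fun s _ => Finset.sum_congr rfl fun t _ => ?_
  ring

lemma mul_bondOp_apply {L : ℕ} (Δ : ℂ) {j k : Fin L} (hjk : j ≠ k)
    (X : Matrix (Chain L) (Chain L) ℂ) (v w : Chain L) :
    (X * bondOp L Δ j k) v w = ∑ s, ∑ t, sixVertex 0 (-2 * Δ) 2 (s, t) (w j, w k) *
      X v (Function.update (Function.update w j s) k t) := by
  simp only [bondOp, mul_add, mul_sub, mul_one, mul_smul_comm, ← mul_assoc, Matrix.add_apply,
    Matrix.sub_apply, Matrix.smul_apply, mul_siteOp_apply, smul_eq_mul,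
    Function.update_of_ne hjk]
  rw [sum_sum_ite_update (j := j) (k := k) w fun u => X v u]
  simp only [Finset.sum_mul]
  simp only [Finset.sum_comm (γ := Fin 2) (s := Finset.univ) (t := Finset.univ)
    (f := fun t s => X v (Function.update (Function.update w k t) j s) * _ * _)]
  simp only [Finset.mul_sum, ← Finset.sum_add_distrib, ← Finset.sum_sub_distrib,
    ← pauli_bond_eq_sixVertex, Function.update_comm hjk, eq_comm (a := w _)]
  refine Finset.sum_congr rfl fun s _ => Finset.sum_congr rfl fun t _ => ?_
  ring

/-- The transfer matrix element with the operator `K` in place of `R` at the site `j`. -/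
noncomputable def defectTrace {L : ℕ} (R K : Matrix (Fin 2 × Fin 2) (Fin 2 × Fin 2) ℂ)
    (v w : Chain L) (j : Fin L) : ℂ :=
  orderedTrace (Function.update (fun i => auxBlock R (v i) (w i)) j (auxBlock K (v j) (w j)))

/-- The commutator of a bond operator with the transfer matrix is a telescoping difference. -/
lemma bondOp_transfer_commutator_apply {n : ℕ} (Δ η lam b c : ℂ)
    (hR : Rmat η lam = sixVertex 1 b c) (h : 1 + b ^ 2 - c ^ 2 = 2 * Δ * b)
    (j : Fin (n + 2)) (v w : Chain (n + 2)) :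
    (bondOp (n + 2) Δ j (j + 1) * transfer (n + 2) η lam) v w -
        (transfer (n + 2) η lam * bondOp (n + 2) Δ j (j + 1)) v w =
      defectTrace (sixVertex 1 b c) (sixVertex 0 (2 * c ^ 2) (2 * c * (b - Δ))) v w j -
        defectTrace (sixVertex 1 b c) (sixVertex 0 (2 * c ^ 2) (2 * c * (b - Δ))) v w (j + 1) := by
  have hj : j ≠ j + 1 := by simp
  obtain ⟨C, hC⟩ := exists_orderedTrace_eq_trace_mul
    (fun i => auxBlock (sixVertex 1 b c) (v i) (w i)) j
  have hv (s t : Fin 2) : transfer (n + 2) η lam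
      (Function.update (Function.update v j s) (j + 1) t) w =
        (auxBlock (sixVertex 1 b c) t (w (j + 1)) *
          auxBlock (sixVertex 1 b c) s (w j) * C).trace := by
    rw [transfer_apply, hR, hC _ fun k h1 h2 => by simp [h1, h2]]
    simp
  have hw (s t : Fin 2) : transfer (n + 2) η lam v
      (Function.update (Function.update w j s) (j + 1) t) =
        (auxBlock (sixVertex 1 b c) (v (j + 1)) t *
          auxBlock (sixVertex 1 b c) (v j) s * C).trace := by
    rw [transfer_apply, hR, hC _ fun k h1 h2 => by simp [h1, h2]]
    simp
  rw [bondOp_mul_apply Δ hj, mul_bondOp_apply Δ hj, defectTrace, defectTrace,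
    hC _ fun k h1 h2 => by simp [h1], hC _ fun k h1 h2 => by simp [h2]]
  simp only [hv, hw, Function.update_self, Function.update_of_ne hj,
    Function.update_of_ne hj.symm]
  rw [← Matrix.trace_sub, ← sub_mul, ← sutherland Δ b c h]
  simp only [sub_mul, Finset.sum_mul, Matrix.trace_sub, Matrix.trace_sum, smul_mul_assoc,
    Matrix.trace_smul, smul_eq_mul]

lemma sinh_weights_relation (η lam : ℂ) (hlam : Complex.sinh (lam + η) ≠ 0) :
    1 + (Complex.sinh lam / Complex.sinh (lam + η)) ^ 2 -
        (Complex.sinh η / Complex.sinh (lam + η)) ^ 2 =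
      2 * Complex.cosh η * (Complex.sinh lam / Complex.sinh (lam + η)) := by
  field_simp
  rw [Complex.sinh_add]
  have h1 := Complex.cosh_sq lam
  have h2 := Complex.cosh_sq η
  grind

/-- The transfer matrix commutes with the XXZ Hamiltonian (with `Δ = cosh η`):
`T(λ) H₀ = H₀ T(λ)`. -/
theorem transfer_commutes_hamiltonian (L : ℕ) [NeZero L] (hL : 2 ≤ L) (J : ℝ)
    (η lam : ℂ) (hη : Complex.sinh η ≠ 0) (hlam : Complex.sinh (lam + η) ≠ 0) :
    transfer L η lam * XXZham L J (Complex.cosh η) =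
      XXZham L J (Complex.cosh η) * transfer L η lam := by
  obtain ⟨n, rfl⟩ := Nat.exists_eq_add_of_le' hL
  have hR : Rmat η lam = sixVertex 1 (Complex.sinh lam / Complex.sinh (lam + η))
    (Complex.sinh η / Complex.sinh (lam + η)) := rfl
  have hH : XXZham (n + 2) J (Complex.cosh η) =
      (J : ℂ) • ∑ j, bondOp (n + 2) (Complex.cosh η) j (j + 1) := rfl
  rw [hH, mul_smul_comm, smul_mul_assoc]
  congr 1
  ext v w
  rw [eq_comm, ← sub_eq_zero, Finset.sum_mul, Finset.mul_sum, Matrix.sum_apply, Matrix.sum_apply,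
    ← Finset.sum_sub_distrib]
  simp only [bondOp_transfer_commutator_apply _ η lam _ _ hR (sinh_weights_relation η lam hlam),
    Finset.sum_sub_distrib]
  rw [sub_eq_zero]
  exact (Equiv.sum_comp (Equiv.addRight (1 : Fin (n + 2))) _).symm
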